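/- arXiv:1004.1879 — 9 statements merged into one kernel-verified Lean document; each statement's English description precedes it below -/
import Mathlib

section
/- Every Q-point is a weak 𝒲-ultrafilter: if 𝒰 is a Q-point on ℕ, then for every finite-to-one function f : ℕ → ℕ there exists U ∈ 𝒰 such that the image f[U] is not an AP-set. -/
open Set Filter Cardinal

/-- A set `A ⊆ ℕ` is an AP-set if it contains arithmetic progressions of every finite length. -/
def IsAPSet (A : Set ℕ) : Prop :=
  ∀ k : ℕ, ∃ a d : ℕ, 1 ≤ d ∧ ∀ i < k, a + i * d ∈ A

/-- `A` contains a 3-term arithmetic progression `{a, a+d, a+2d}` with `d ≥ 1`. -/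
def Has3AP (A : Set ℕ) : Prop :=
  ∃ a d : ℕ, 1 ≤ d ∧ a ∈ A ∧ a + d ∈ A ∧ a + 2 * d ∈ A

/-- `f` is finite-to-one: each fiber is finite. -/
def FiniteToOne (f : ℕ → ℕ) : Prop := ∀ m : ℕ, (f ⁻¹' {m}).Finite

/-- A nonprincipal ultrafilter `𝒰` on ℕ is a Q-point if for every partition of ℕ into finite
sets there is a member of `𝒰` meeting each piece in at most one point. -/
def IsQPoint (𝒰 : Ultrafilter ℕ) : Prop :=
  (∀ a : ℕ, 𝒰 ≠ pure a) ∧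
    ∀ Q : ℕ → Set ℕ, (∀ n, (Q n).Finite) →
      (∀ m n, m ≠ n → Disjoint (Q m) (Q n)) → (⋃ n, Q n) = Set.univ →
      ∃ A ∈ 𝒰, ∀ n, (A ∩ Q n).Subsingleton

/-- A filter base on ℕ. -/
def IsFilterBase (𝓕 : Set (Set ℕ)) : Prop :=
  𝓕.Nonempty ∧ ∀ A ∈ 𝓕, ∀ B ∈ 𝓕, ∃ C ∈ 𝓕, C ⊆ A ∩ B

/-- Property (♠): every member of the family has at least `k` elements in some dyadic
interval `[2ⁿ, 2ⁿ⁺¹)`, for every `k`. -/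
def Spade (𝓕 : Set (Set ℕ)) : Prop :=
  ∀ F ∈ 𝓕, ∀ k : ℕ, ∃ n : ℕ, k ≤ (F ∩ Set.Ico (2 ^ n) (2 ^ (n + 1))).ncard

/-- A dense subset of a poset. -/
def PosetDense {P : Type} [PartialOrder P] (D : Set P) : Prop :=
  ∀ p : P, ∃ q ∈ D, q ≤ p

/-- A filter on a poset: nonempty, upward closed, downward directed. -/
def PosetFilter {P : Type} [PartialOrder P] (G : Set P) : Prop :=
  G.Nonempty ∧ (∀ p ∈ G, ∀ q, p ≤ q → q ∈ G) ∧
    ∀ p ∈ G, ∀ q ∈ G, ∃ r ∈ G, r ≤ p ∧ r ≤ q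

/-- Martin's axiom for countable posets. -/
def MActble : Prop :=
  ∀ (P : Type) [PartialOrder P] [Countable P] [Nonempty P],
    ∀ 𝒟 : Set (Set P), (∀ D ∈ 𝒟, PosetDense D) → #𝒟 < Cardinal.continuum →
      ∃ G : Set P, PosetFilter G ∧ ∀ D ∈ 𝒟, (G ∩ D).Nonempty

/-- A rapid ultrafilter: the enumeration functions of its members form a dominating family. -/
def IsRapid (𝒰 : Ultrafilter ℕ) : Prop :=
  ∀ h : ℕ → ℕ, ∃ B ∈ 𝒰, B.Infinite ∧ ∀ᶠ n in Filter.atTop, h n ≤ Nat.nth (· ∈ B) n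

/-- A hereditarily rapid ultrafilter: all its images under maps `ℕ → ℕ` are rapid. -/
def IsHereditarilyRapid (𝒰 : Ultrafilter ℕ) : Prop :=
  IsRapid 𝒰 ∧ ∀ f : ℕ → ℕ, IsRapid (Ultrafilter.map f 𝒰)

/-- A set containing at most one number of each binary length is not an AP-set. -/
theorem not_isAPSet_of_injOn_size {A : Set ℕ} (hA : A.InjOn Nat.size) : ¬ IsAPSet A := by
  intro h
  obtain ⟨a, d, hd, hmem⟩ := h 5
  have size_lt {x y : ℕ} (hx : x ∈ A) (hy : y ∈ A) (hxy : x < y) : x.size < y.size :=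
    (Nat.size_le_size hxy.le).lt_of_ne fun he => hxy.ne (hA hx hy he)
  have h₁ := size_lt (hmem 2 (by omega)) (hmem 3 (by omega)) (by omega)
  have h₂ := size_lt (hmem 3 (by omega)) (hmem 4 (by omega)) (by omega)
  have h₃ := Nat.lt_size_self (a + 2 * d)
  have h₄ : 2 ^ ((a + 2 * d).size + 1) ≤ a + 4 * d := Nat.lt_size.1 (by omega)
  rw [pow_succ] at h₄
  omega

theorem FiniteToOne.finite_preimage {f : ℕ → ℕ} (hf : FiniteToOne f) {s : Set ℕ}
    (hs : s.Finite) : (f ⁻¹' s).Finite :=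
  hs.preimage' fun m _ => hf m

theorem finite_size_eq (n : ℕ) : {m : ℕ | m.size = n}.Finite :=
  (Set.finite_lt_nat (2 ^ n)).subset fun _ hm => Nat.size_le.1 (le_of_eq hm)

/-- Every Q-point is a weak 𝒲-ultrafilter. -/
theorem qpoint_is_weak_W_ultrafilter (𝒰 : Ultrafilter ℕ) (hQ : IsQPoint 𝒰)
    (f : ℕ → ℕ) (hf : FiniteToOne f) :
    ∃ U ∈ 𝒰, ¬ IsAPSet (f '' U) := by
  obtain ⟨A, hA, hsub⟩ := hQ.2 (fun n => f ⁻¹' {m | m.size = n})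
    (fun n => hf.finite_preimage (finite_size_eq n))
    (fun m n hmn => Set.disjoint_left.2 fun x hm hn => hmn (Eq.trans (Eq.symm hm) hn))
    (Set.eq_univ_of_forall fun x => Set.mem_iUnion.2 ⟨(f x).size, rfl⟩)
  refine ⟨A, hA, not_isAPSet_of_injOn_size ?_⟩
  rintro _ ⟨u, hu, rfl⟩ _ ⟨v, hv, rfl⟩ huv
  exact congrArg f (hsub (f v).size ⟨hu, huv⟩ ⟨hv, rfl⟩)
end

section
/- Assume MA_ctble. Let 𝓕 be a filter base on ℕ of cardinality less than 𝔠 with property (♠), and let f : ℕ → ℕ. Then there exists an infinite set G ⊆ ℕ such that f[G] is not an AP-set and for every F ∈ 𝓕 and every k ∈ ℕ there exists n ∈ ℕ with |F ∩ G ∩ [2ⁿ, 2ⁿ⁺¹)| ≥ k (i.e. the filter base generated by 𝓕 and G again has property (♠)). -/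
open Set Filter Cardinal

/-- The values that would form a 3-term arithmetic progression with two elements of `T`. -/
def apCompletions (T : Finset ℕ) : Finset ℕ :=
  (T ×ˢ T).image (fun p => 2 * p.1 - p.2) ∪ (T ×ˢ T).image (fun p => (p.1 + p.2) / 2)

theorem card_apCompletions_le (T : Finset ℕ) : (apCompletions T).card ≤ 2 * T.card ^ 2 := by
  have h₁ := Finset.card_union_le ((T ×ˢ T).image (fun p => 2 * p.1 - p.2))
    ((T ×ˢ T).image (fun p => (p.1 + p.2) / 2))
  have h₂ := Finset.card_image_le (s := T ×ˢ T) (f := fun p => 2 * p.1 - p.2)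
  have h₃ := Finset.card_image_le (s := T ×ˢ T) (f := fun p => (p.1 + p.2) / 2)
  rw [Finset.card_product] at h₂ h₃
  unfold apCompletions
  nlinarith

theorem subset_apCompletions (T : Finset ℕ) : T ⊆ apCompletions T := by
  intro x hx
  exact Finset.mem_union_left _ (Finset.mem_image.2 ⟨(x, x), by simp [hx], by dsimp only; omega⟩)

theorem not_has3AP_insert {T : Finset ℕ} {v : ℕ} (hT : ¬ Has3AP (T : Set ℕ))
    (hv : v ∉ apCompletions T) : ¬ Has3AP (insert v (T : Set ℕ)) := by
  have h₁ : ∀ x ∈ T, ∀ a ∈ T, v ≠ 2 * x - a := fun x hx a ha h =>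
    hv (Finset.mem_union_left _ (Finset.mem_image.2 ⟨(x, a), by simp [hx, ha], h.symm⟩))
  have h₂ : ∀ x ∈ T, ∀ a ∈ T, v ≠ (x + a) / 2 := fun x hx a ha h =>
    hv (Finset.mem_union_right _ (Finset.mem_image.2 ⟨(x, a), by simp [hx, ha], h.symm⟩))
  rintro ⟨a, d, hd, ha, hb, hc⟩
  simp only [Set.mem_insert_iff, Finset.mem_coe] at ha hb hc
  rcases ha with ha | ha <;> rcases hb with hb | hb <;> rcases hc with hc | hc <;> try omega
  · exact h₁ _ hb _ hc (by omega)
  · exact h₂ _ ha _ hc (by omega)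
  · exact h₁ _ hb _ ha (by omega)
  · exact hT ⟨a, d, hd, ha, hb, hc⟩

theorem Has3AP.mono {A B : Set ℕ} (hAB : A ⊆ B) : Has3AP A → Has3AP B
  | ⟨a, d, hd, ha, hb, hc⟩ => ⟨a, d, hd, hAB ha, hAB hb, hAB hc⟩

theorem IsAPSet.has3AP {A : Set ℕ} (hA : IsAPSet A) : Has3AP A := by
  obtain ⟨a, d, hd, h⟩ := hA 3
  exact ⟨a, d, hd, by simpa using h 0, by simpa using h 1, by simpa using h 2⟩

theorem not_isAPSet_of_forall_le {A : Set ℕ} {N : ℕ} (hA : ∀ x ∈ A, x ≤ N) : ¬ IsAPSet A := by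
  intro h
  obtain ⟨a, d, hd, h⟩ := h (N + 2)
  have := hA _ (h (N + 1) (by omega))
  nlinarith

/-- A set of indices on which `f` takes many values contains `k` indices that can be added
to `S` without creating a 3-term arithmetic progression among the values of `f`. -/
theorem exists_subset_card_eq_not_has3AP (f : ℕ → ℕ) {S X : Finset ℕ} {k : ℕ}
    (hS : ¬ Has3AP (f '' S)) (hX : 2 * (S.card + k) ^ 2 < (X.image f).card) :
    ∀ j ≤ k, ∃ Y ⊆ X, Y.card = j ∧ ¬ Has3AP (f '' (S ∪ Y : Finset ℕ)) := by
  intro j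
  induction j with
  | zero => exact fun _ => ⟨∅, by simp, rfl, by simpa using hS⟩
  | succ j ih =>
    intro hj
    obtain ⟨Y, hYX, hY, hYf⟩ := ih (by omega)
    have hT : ((S ∪ Y).image f).card ≤ S.card + k :=
      Finset.card_image_le.trans ((Finset.card_union_le _ _).trans (by omega))
    have hcard : (apCompletions ((S ∪ Y).image f)).card < (X.image f).card :=
      ((card_apCompletions_le _).trans (by gcongr)).trans_lt hX
    obtain ⟨v, hvX, hv⟩ := Finset.exists_mem_notMem_of_card_lt_card hcard
    obtain ⟨x, hx, rfl⟩ := Finset.mem_image.1 hvX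
    have hxY : x ∉ Y := fun h => hv (subset_apCompletions _
      (Finset.mem_image_of_mem f (Finset.mem_union_right _ h)))
    refine ⟨insert x Y, Finset.insert_subset hx hYX, by simp [hxY, hY], ?_⟩
    have := not_has3AP_insert (by rwa [Finset.coe_image]) hv
    rwa [Finset.union_insert, Finset.coe_insert, Set.image_insert_eq, ← Finset.coe_image]

/-- Every finite condition `S` can be extended by `k` elements of any large enough finite set
on which the values of `f` are large. -/
theorem exists_card_bound_extension (f : ℕ → ℕ) {S : Finset ℕ} (hS : ¬ Has3AP (f '' S)) (k : ℕ) :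
    ∃ N M : ℕ, ∀ X : Finset ℕ, (∀ x ∈ X, N < f x) → M ≤ X.card →
      ∃ Y ⊆ X, k ≤ Y.card ∧ ¬ Has3AP (f '' (S ∪ Y : Finset ℕ)) := by
  refine ⟨(apCompletions (S.image f)).sup id, (2 * (S.card + k) ^ 2 + 1) * k, fun X hXN hXM => ?_⟩
  by_cases hfib : ∃ v ∈ X.image f, k ≤ (X.filter (f · = v)).card
  · obtain ⟨v, hvX, hk⟩ := hfib
    refine ⟨X.filter (f · = v), Finset.filter_subset _ _, hk, fun h => ?_⟩
    obtain ⟨x, hx, rfl⟩ := Finset.mem_image.1 hvX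
    have hv : f x ∉ apCompletions (S.image f) := fun hmem =>
      absurd (hXN x hx) (not_lt.2 (Finset.le_sup (f := id) hmem))
    refine not_has3AP_insert (by rwa [Finset.coe_image]) hv (h.mono ?_)
    rintro _ ⟨y, hy, rfl⟩
    simp only [Finset.coe_union, Finset.coe_filter, Set.mem_union, Finset.mem_coe,
      Set.mem_ofPred_eq] at hy
    rcases hy with hy | hy
    · exact Or.inr (Finset.mem_coe.2 (Finset.mem_image_of_mem f hy))
    · exact Or.inl hy.2
  · push Not at hfib
    by_cases hk : k = 0
    · exact ⟨∅, by simp, by simp [hk], by simpa using hS⟩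
    have hX : 2 * (S.card + k) ^ 2 < (X.image f).card := by
      have h := Finset.card_le_mul_card_image (f := f) X k (fun v hv => (hfib v hv).le)
      have hle := hXM.trans h
      rw [mul_comm k] at hle
      exact Nat.lt_of_succ_le (Nat.le_of_mul_le_mul_right hle (by omega))
    obtain ⟨Y, hYX, hY, hYf⟩ := exists_subset_card_eq_not_has3AP f hS hX k le_rfl
    exact ⟨Y, hYX, hY.ge, hYf⟩

theorem infinite_of_forall_exists_le_ncard {F G : Set ℕ} {I : ℕ → Set ℕ}
    (h : ∀ k : ℕ, ∃ n, k ≤ (F ∩ G ∩ I n).ncard) : G.Infinite := by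
  intro hG
  obtain ⟨n, hn⟩ := h (G.ncard + 1)
  have : (F ∩ G ∩ I n).ncard ≤ G.ncard := Set.ncard_le_ncard (fun x hx => hx.1.2) hG
  omega

/-- If no sublevel set of `f` is compatible with the (♠) filter base `𝓕`, then every
superlevel set is. -/
theorem Spade.exists_le_ncard_superlevel {𝓕 : Set (Set ℕ)} (hbase : IsFilterBase 𝓕)
    (hsp : Spade 𝓕) {f : ℕ → ℕ} {N : ℕ}
    (hN : ∃ F ∈ 𝓕, ∃ k : ℕ, ∀ n : ℕ,
      (F ∩ {x | f x ≤ N} ∩ Set.Ico (2 ^ n) (2 ^ (n + 1))).ncard < k)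
    {F : Set ℕ} (hF : F ∈ 𝓕) (k : ℕ) :
    ∃ n : ℕ, k ≤ (F ∩ {x | N < f x} ∩ Set.Ico (2 ^ n) (2 ^ (n + 1))).ncard := by
  obtain ⟨E, hE, l, hl⟩ := hN
  obtain ⟨C, hC, hCsub⟩ := hbase.2 E hE F hF
  obtain ⟨n, hn⟩ := hsp C hC (k + l)
  refine ⟨n, ?_⟩
  have hsub : C ∩ Set.Ico (2 ^ n) (2 ^ (n + 1)) ⊆
      (F ∩ {x | N < f x} ∩ Set.Ico (2 ^ n) (2 ^ (n + 1))) ∪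
        (E ∩ {x | f x ≤ N} ∩ Set.Ico (2 ^ n) (2 ^ (n + 1))) := by
    rintro x ⟨hxC, hxI⟩
    rcases lt_or_ge N (f x) with h | h
    · exact Or.inl ⟨⟨(hCsub hxC).2, h⟩, hxI⟩
    · exact Or.inr ⟨⟨(hCsub hxC).1, h⟩, hxI⟩
  have h₁ := Set.ncard_le_ncard hsub
    (((Set.finite_Ico _ _).inter_of_right _).union ((Set.finite_Ico _ _).inter_of_right _))
  have h₂ := h₁.trans (Set.ncard_union_le _ _)
  have h₃ := hl n
  omega

/-- Finite sets whose `f`-image has no 3-term arithmetic progression, ordered by reverse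
inclusion. -/
abbrev APFreeCondition (f : ℕ → ℕ) : Type := {S : Finset ℕ // ¬ Has3AP (f '' S)}ᵒᵈ

/-- The union of a filter of conditions has an `f`-image without 3-term arithmetic
progressions. -/
theorem not_has3AP_image_iUnion {f : ℕ → ℕ} {H : Set (APFreeCondition f)} (hH : PosetFilter H) :
    ¬ Has3AP (f '' {x | ∃ p ∈ H, x ∈ (OrderDual.ofDual p).1}) := by
  rintro ⟨a, d, hd, ⟨x, ⟨p, hp, hxp⟩, hx⟩, ⟨y, ⟨q, hq, hyq⟩, hy⟩, ⟨z, ⟨r, hr, hzr⟩, hz⟩⟩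
  obtain ⟨s, hs, hsp, hsq⟩ := hH.2.2 p hp q hq
  obtain ⟨t, -, hts, htr⟩ := hH.2.2 s hs r hr
  have hle : ∀ {u v : APFreeCondition f}, u ≤ v →
      (OrderDual.ofDual v).1 ⊆ (OrderDual.ofDual u).1 := fun h => h
  exact (OrderDual.ofDual t).2 ⟨a, d, hd, ⟨x, hle (hts.trans hsp) hxp, hx⟩,
    ⟨y, hle (hts.trans hsq) hyq, hy⟩, ⟨z, hle htr hzr, hz⟩⟩

/-- Under MA_ctble, a small filter base with property (♠) can be enlarged by an
infinite set `G` with `f[G]` not an AP-set, keeping property (♠). -/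
theorem exists_G_not_APimage_keeping_spade (hMA : MActble) (𝓕 : Set (Set ℕ))
    (hbase : IsFilterBase 𝓕) (hcard : #𝓕 < Cardinal.continuum) (hsp : Spade 𝓕)
    (f : ℕ → ℕ) :
    ∃ G : Set ℕ, G.Infinite ∧ ¬ IsAPSet (f '' G) ∧
      ∀ F ∈ 𝓕, ∀ k : ℕ, ∃ n : ℕ, k ≤ (F ∩ G ∩ Set.Ico (2 ^ n) (2 ^ (n + 1))).ncard := by
  suffices h : ∃ G : Set ℕ, ¬ IsAPSet (f '' G) ∧
      ∀ F ∈ 𝓕, ∀ k : ℕ, ∃ n : ℕ, k ≤ (F ∩ G ∩ Set.Ico (2 ^ n) (2 ^ (n + 1))).ncard by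
    obtain ⟨G, hG, hGF⟩ := h
    obtain ⟨F, hF⟩ := hbase.1
    exact ⟨G, infinite_of_forall_exists_le_ncard (hGF F hF), hG, hGF⟩
  by_cases hbdd : ∃ N : ℕ, ∀ F ∈ 𝓕, ∀ k : ℕ, ∃ n : ℕ,
      k ≤ (F ∩ {x | f x ≤ N} ∩ Set.Ico (2 ^ n) (2 ^ (n + 1))).ncard
  · obtain ⟨N, hN⟩ := hbdd
    refine ⟨{x | f x ≤ N}, not_isAPSet_of_forall_le (N := N) ?_, hN⟩
    rintro _ ⟨x, hx, rfl⟩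
    exact hx
  push Not at hbdd
  let D : 𝓕 × ℕ → Set (APFreeCondition f) := fun c => {p | ∃ n : ℕ,
    c.2 ≤ (c.1.1 ∩ (OrderDual.ofDual p).1 ∩ Set.Ico (2 ^ n) (2 ^ (n + 1))).ncard}
  have hDdense : ∀ E ∈ Set.range D, PosetDense E := by
    rintro _ ⟨⟨⟨F, hF⟩, k⟩, rfl⟩ p
    obtain ⟨N, M, hNM⟩ := exists_card_bound_extension f (OrderDual.ofDual p).2 k
    obtain ⟨n, hn⟩ := hsp.exists_le_ncard_superlevel hbase (hbdd N) hF M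
    have hfin : (F ∩ {x | N < f x} ∩ Set.Ico (2 ^ n) (2 ^ (n + 1))).Finite :=
      (Set.finite_Ico _ _).inter_of_right _
    rw [Set.ncard_eq_toFinset_card _ hfin] at hn
    obtain ⟨Y, hYX, hkY, hY⟩ := hNM _ (fun x hx => (hfin.mem_toFinset.1 hx).1.2) hn
    refine ⟨OrderDual.toDual ⟨_, hY⟩, ⟨n, ?_⟩,
      Finset.subset_union_left (s₁ := (OrderDual.ofDual p).1)⟩
    rw [← Set.ncard_coe_finset] at hkY
    refine hkY.trans (Set.ncard_le_ncard (fun x hx => ?_) ((Set.finite_Ico _ _).inter_of_right _))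
    have hx' := hfin.mem_toFinset.1 (hYX hx)
    exact ⟨⟨hx'.1.1, Finset.mem_union_right _ hx⟩, hx'.2⟩
  have hDcard : #(Set.range D) < Cardinal.continuum := by
    refine Cardinal.mk_range_le.trans_lt ?_
    rw [Cardinal.mk_prod, Cardinal.lift_id, Cardinal.lift_id, Cardinal.mk_nat]
    exact Cardinal.mul_lt_of_lt Cardinal.aleph0_le_continuum hcard Cardinal.aleph0_lt_continuum
  have : Countable (APFreeCondition f) :=
    inferInstanceAs (Countable {S : Finset ℕ // ¬ Has3AP (f '' S)})
  have : Nonempty (APFreeCondition f) := ⟨OrderDual.toDual ⟨∅, by simp [Has3AP]⟩⟩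
  obtain ⟨H, hH, hHD⟩ := hMA (APFreeCondition f) _ hDdense hDcard
  refine ⟨_, fun h => not_has3AP_image_iUnion hH h.has3AP, fun F hF k => ?_⟩
  obtain ⟨p, hp, n, hn⟩ := hHD _ ⟨(⟨F, hF⟩, k), rfl⟩
  refine ⟨n, hn.trans (Set.ncard_le_ncard ?_ ((Set.finite_Ico _ _).inter_of_right _))⟩
  exact fun x hx => ⟨⟨hx.1.1, p, hp, hx.1.2⟩, hx.2⟩
end

section
/- Let B ⊆ ℕ be a finite set containing no 3-term arithmetic progression, let k ∈ ℕ, and let A ⊆ ℕ be a finite set with |A| ≥ 3·(|B| + k)² all of whose elements are greater than 3·max B. Then there exists C ⊆ A with |C| = k such that B ∪ C contains no 3-term arithmetic progression. -/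
open Set Filter Cardinal

/-- Adjoining to a 3-AP-free set a point that is neither a reflection `2 * v - u` nor a
midpoint `(u + v) / 2` of two of its points keeps it 3-AP-free. -/
theorem not_has3AP_insert_s4 {S : Finset ℕ} (hS : ¬ Has3AP (↑S : Set ℕ)) {x : ℕ}
    (hreflect : ∀ u ∈ S, ∀ v ∈ S, 2 * v - u ≠ x) (hmid : ∀ u ∈ S, ∀ v ∈ S, (u + v) / 2 ≠ x) :
    ¬ Has3AP (↑(insert x S) : Set ℕ) := by
  rintro ⟨a, d, hd, h₀, h₁, h₂⟩
  simp only [Finset.coe_insert, Set.mem_insert_iff, Finset.mem_coe] at h₀ h₁ h₂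
  rcases h₀ with h₀ | h₀ <;> rcases h₁ with h₁ | h₁ <;> rcases h₂ with h₂ | h₂ <;> try omega
  · exact hreflect _ h₂ _ h₁ (by omega)
  · exact hmid _ h₀ _ h₂ (by omega)
  · exact hreflect _ h₀ _ h₁ (by omega)
  · exact hS ⟨a, d, hd, h₀, h₁, h₂⟩

/-- A set of more than `2 * |S| ^ 2` numbers has a point outside the 3-AP-free set `S` that can be
adjoined to `S` without creating a 3-term arithmetic progression. -/
theorem exists_insert_no3AP {S A : Finset ℕ} (hS : ¬ Has3AP (↑S : Set ℕ))
    (hcard : 2 * S.card ^ 2 < A.card) :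
    ∃ x ∈ A, x ∉ S ∧ ¬ Has3AP (↑(insert x S) : Set ℕ) := by
  let R := Finset.image₂ (fun u v => 2 * v - u) S S
  let M := Finset.image₂ (fun u v => (u + v) / 2) S S
  have hlt : (R ∪ M).card < A.card := by
    have h₁ : R.card ≤ S.card * S.card := Finset.card_image₂_le _ _ _
    have h₂ : M.card ≤ S.card * S.card := Finset.card_image₂_le _ _ _
    have h₃ := Finset.card_union_le R M
    nlinarith
  obtain ⟨x, hxA, hx⟩ := Finset.exists_mem_notMem_of_card_lt_card hlt
  simp only [R, M, Finset.mem_union, Finset.mem_image₂, not_or, not_exists, not_and] at hx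
  exact ⟨x, hxA, fun hxS => hx.1 x hxS x hxS (by omega), not_has3AP_insert_s4 hS hx.1 hx.2⟩

/-- From a large finite set of big numbers one can pick `k` elements whose union
with a 3-AP-free set `B` remains 3-AP-free. -/
theorem exists_extension_no3AP (B : Finset ℕ) (hB : ¬ Has3AP (↑B : Set ℕ)) (k : ℕ)
    (A : Finset ℕ) (hcard : 3 * (B.card + k) ^ 2 ≤ A.card)
    (hgt : ∀ a ∈ A, 3 * B.sup id < a) :
    ∃ C ⊆ A, C.card = k ∧ ¬ Has3AP (↑(B ∪ C) : Set ℕ) := by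
  clear hgt
  induction k with
  | zero => exact ⟨∅, by simp, rfl, by simpa using hB⟩
  | succ k ih =>
    obtain ⟨C, hCA, hCk, hC⟩ :=
      ih (le_trans (by gcongr; omega) hcard)
    have hlt : 2 * (B ∪ C).card ^ 2 < A.card := by
      have h := Finset.card_union_le B C
      rw [hCk] at h
      nlinarith
    obtain ⟨x, hxA, hxS, hx⟩ := exists_insert_no3AP hC hlt
    refine ⟨insert x C, Finset.insert_subset hxA hCA, ?_, ?_⟩
    · rw [Finset.card_insert_of_notMem fun h => hxS (Finset.mem_union_right _ h), hCk]
    · rwa [Finset.union_insert]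
end

section
/- Every filter base 𝓕 on ℕ with property (♠) can be extended to an ultrafilter that is not a Q-point: there exists an ultrafilter 𝒰 on ℕ with 𝓕 ⊆ 𝒰 such that 𝒰 has property (♠), and consequently 𝒰 is not a Q-point. -/
open Set Filter Cardinal

/-- A set of naturals meeting the dyadic intervals `[2ⁿ, 2ⁿ⁺¹)` in uniformly boundedly many
points. -/
def DyadicallyBounded (A : Set ℕ) : Prop :=
  ∃ k : ℕ, ∀ n : ℕ, (A ∩ Set.Ico (2 ^ n) (2 ^ (n + 1))).ncard ≤ k

lemma DyadicallyBounded.mono {A B : Set ℕ} (hB : DyadicallyBounded B) (h : A ⊆ B) :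
    DyadicallyBounded A := by
  obtain ⟨k, hk⟩ := hB
  exact ⟨k, fun n => (Set.ncard_le_ncard (Set.inter_subset_inter_left _ h)
    ((Set.finite_Ico _ _).inter_of_right _)).trans (hk n)⟩

lemma DyadicallyBounded.union {A B : Set ℕ} (hA : DyadicallyBounded A)
    (hB : DyadicallyBounded B) : DyadicallyBounded (A ∪ B) := by
  obtain ⟨k, hk⟩ := hA
  obtain ⟨l, hl⟩ := hB
  refine ⟨k + l, fun n => ?_⟩
  rw [Set.union_inter_distrib_right]
  exact (Set.ncard_union_le _ _).trans (Nat.add_le_add (hk n) (hl n))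

lemma dyadicallyBounded_empty : DyadicallyBounded ∅ := ⟨0, fun n => by simp⟩

lemma spade_iff_forall_not_dyadicallyBounded {𝓕 : Set (Set ℕ)} :
    Spade 𝓕 ↔ ∀ F ∈ 𝓕, ¬ DyadicallyBounded F := by
  refine forall₂_congr fun F _ => ⟨?_, ?_⟩
  · rintro h ⟨k, hk⟩
    obtain ⟨n, hn⟩ := h (k + 1)
    exact absurd (hn.trans (hk n)) (by omega)
  · intro h k
    by_contra! hk
    exact h ⟨k, fun n => (hk n).le⟩

/-- The filter of sets containing a member of a filter base up to a dyadically bounded set. -/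
def IsFilterBase.dyadicFilter {𝓕 : Set (Set ℕ)} (h : IsFilterBase 𝓕) : Filter ℕ where
  sets := {A | ∃ F ∈ 𝓕, DyadicallyBounded (F \ A)}
  univ_sets := by
    obtain ⟨F, hF⟩ := h.1
    exact ⟨F, hF, by simpa using dyadicallyBounded_empty⟩
  sets_of_superset := by
    rintro A B ⟨F, hF, hA⟩ hAB
    exact ⟨F, hF, hA.mono (Set.sdiff_subset_sdiff_right hAB)⟩
  inter_sets := by
    rintro A B ⟨F, hF, hA⟩ ⟨G, hG, hB⟩
    obtain ⟨C, hC, hCFG⟩ := h.2 F hF G hG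
    refine ⟨C, hC, (hA.union hB).mono ?_⟩
    rw [Set.sdiff_inter]
    exact Set.union_subset_union
      (Set.sdiff_subset_sdiff_left (hCFG.trans Set.inter_subset_left))
      (Set.sdiff_subset_sdiff_left (hCFG.trans Set.inter_subset_right))

lemma IsFilterBase.mem_dyadicFilter {𝓕 : Set (Set ℕ)} (h : IsFilterBase 𝓕) {A : Set ℕ} :
    A ∈ h.dyadicFilter ↔ ∃ F ∈ 𝓕, DyadicallyBounded (F \ A) := Iff.rfl

lemma IsFilterBase.dyadicFilter_neBot {𝓕 : Set (Set ℕ)} (h : IsFilterBase 𝓕)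
    (hsp : Spade 𝓕) : h.dyadicFilter.NeBot := by
  refine Filter.neBot_iff.2 fun hbot => ?_
  obtain ⟨F, hF, hb⟩ := h.mem_dyadicFilter.1 (Filter.empty_mem_iff_bot.2 hbot)
  rw [Set.sdiff_empty] at hb
  exact spade_iff_forall_not_dyadicallyBounded.1 hsp F hF hb

/-- An ultrafilter with property (♠) is not a Q-point, as witnessed by the partition into
the fibers of the binary logarithm. -/
lemma not_isQPoint_of_spade {𝒰 : Ultrafilter ℕ} (h : Spade {A : Set ℕ | A ∈ 𝒰}) :
    ¬ IsQPoint 𝒰 := by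
  rintro ⟨-, hQ⟩
  obtain ⟨A, hA, hsub⟩ := hQ (fun n => Nat.log 2 ⁻¹' {n})
    (fun n => (Set.finite_Iio (2 ^ (n + 1))).subset fun m hm => by
      have hm : Nat.log 2 m = n := hm
      exact hm ▸ Nat.lt_pow_succ_log_self one_lt_two m)
    (fun m n hmn => Disjoint.preimage _ (Set.disjoint_singleton.2 hmn))
    (Set.eq_univ_of_forall fun m => Set.mem_iUnion.2 ⟨Nat.log 2 m, rfl⟩)
  refine spade_iff_forall_not_dyadicallyBounded.1 h A hA ⟨1, fun n => ?_⟩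
  refine Set.ncard_le_one_iff_subsingleton.2 ((hsub n).anti ?_)
  exact Set.inter_subset_inter_right _ fun m hm =>
    Nat.log_eq_of_pow_le_of_lt_pow hm.1 hm.2

/-- Every filter base with property (♠) extends to an ultrafilter with property
(♠), which is therefore not a Q-point. -/
theorem spade_base_extends_to_nonQpoint (𝓕 : Set (Set ℕ)) (hbase : IsFilterBase 𝓕)
    (hsp : Spade 𝓕) :
    ∃ 𝒰 : Ultrafilter ℕ, (∀ F ∈ 𝓕, F ∈ 𝒰) ∧ Spade {A : Set ℕ | A ∈ 𝒰} ∧ ¬ IsQPoint 𝒰 := by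
  have := hbase.dyadicFilter_neBot hsp
  have hle : ∀ A ∈ hbase.dyadicFilter, A ∈ Ultrafilter.of hbase.dyadicFilter :=
    Ultrafilter.of_le _
  have hspade : Spade {A : Set ℕ | A ∈ Ultrafilter.of hbase.dyadicFilter} := by
    refine spade_iff_forall_not_dyadicallyBounded.2 fun A hA hb => ?_
    obtain ⟨F, hF⟩ := hbase.1
    refine Ultrafilter.compl_mem_iff_notMem.1 (hle Aᶜ ⟨F, hF, hb.mono ?_⟩) hA
    rw [Set.sdiff_compl]
    exact Set.inter_subset_right
  refine ⟨Ultrafilter.of hbase.dyadicFilter, fun F hF => hle F ⟨F, hF, ?_⟩, hspade,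
    not_isQPoint_of_spade hspade⟩
  simpa using dyadicallyBounded_empty
end

section
/- Let 𝓕 be a filter base on ℕ with property (♠) and let A ⊆ ℕ. Then either for every F ∈ 𝓕 and every k ∈ ℕ there exists n with |F ∩ A ∩ [2ⁿ, 2ⁿ⁺¹)| ≥ k, or for every F ∈ 𝓕 and every k ∈ ℕ there exists n with |F ∩ (ℕ ∖ A) ∩ [2ⁿ, 2ⁿ⁺¹)| ≥ k. In particular, the filter base generated by 𝓕 together with A, or the one generated by 𝓕 together with ℕ ∖ A, again has property (♠). -/
open Set Filter Cardinal

/-- For a filter base with property (♠) and any `A ⊆ ℕ`, property (♠) is kept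
after adding `A` or after adding its complement. -/
theorem spade_extend_by_A_or_compl (𝓕 : Set (Set ℕ)) (hbase : IsFilterBase 𝓕)
    (hsp : Spade 𝓕) (A : Set ℕ) :
    (∀ F ∈ 𝓕, ∀ k : ℕ, ∃ n : ℕ, k ≤ (F ∩ A ∩ Set.Ico (2 ^ n) (2 ^ (n + 1))).ncard) ∨
      (∀ F ∈ 𝓕, ∀ k : ℕ, ∃ n : ℕ,
        k ≤ (F ∩ (Set.univ \ A) ∩ Set.Ico (2 ^ n) (2 ^ (n + 1))).ncard) := by
  by_contra! h
  obtain ⟨⟨F, hF, k, hk⟩, G, hG, l, hl⟩ := h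
  obtain ⟨C, hC, hCFG⟩ := hbase.2 F hF G hG
  obtain ⟨n, hn⟩ := hsp C hC (k + l)
  have hfin : (Set.Ico (2 ^ n) (2 ^ (n + 1)) : Set ℕ).Finite := Set.finite_Ico _ _
  have hcover : C ∩ Set.Ico (2 ^ n) (2 ^ (n + 1)) ⊆
      (F ∩ A ∩ Set.Ico (2 ^ n) (2 ^ (n + 1))) ∪
        (G ∩ (Set.univ \ A) ∩ Set.Ico (2 ^ n) (2 ^ (n + 1))) := by
    rintro x ⟨hxC, hxI⟩
    obtain ⟨hxF, hxG⟩ := hCFG hxC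
    by_cases hxA : x ∈ A
    · exact Or.inl ⟨⟨hxF, hxA⟩, hxI⟩
    · exact Or.inr ⟨⟨hxG, Set.mem_univ x, hxA⟩, hxI⟩
  have hcard := (Set.ncard_le_ncard hcover
    ((hfin.inter_of_right _).union (hfin.inter_of_right _))).trans (Set.ncard_union_le _ _)
  have := hk n
  have := hl n
  omega
end

section
/- A nonprincipal ultrafilter 𝒰 on ℕ is rapid if and only if 𝒰 is a weak I_g-ultrafilter for every tall summable ideal I_g; explicitly, 𝒰 is rapid if and only if for every g : ℕ → (0, ∞) with Σₙ g(n) = ∞ and limₙ g(n) = 0 and every finite-to-one f : ℕ → ℕ there exists U ∈ 𝒰 with Σ_{a ∈ f[U]} g(a) < ∞. -/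
open Set Filter Cardinal

/-- A function that is summable along a map is summable on the range of that map. -/
lemma Summable.indicator_range {α β E : Type*} [NormedAddCommGroup E] [CompleteSpace E]
    {g : β → E} {φ : α → β} (h : Summable (g ∘ φ)) :
    Summable ((Set.range φ).indicator g) := by
  rw [← summable_subtype_iff_indicator]
  have hs := h.comp_injective (Set.rangeSplitting_injective φ)
  refine hs.congr fun x => ?_
  simp [Set.apply_rangeSplitting]

/-- Members of a nonprincipal ultrafilter stay members after removing a finite set. -/
lemma Ultrafilter.sdiff_finite_mem {α : Type*} {𝒰 : Ultrafilter α} (hnp : ∀ a, 𝒰 ≠ pure a)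
    {U : Set α} (hU : U ∈ 𝒰) {s : Set α} (hs : s.Finite) : U \ s ∈ 𝒰 := by
  have hle : (𝒰 : Filter α) ≤ Filter.cofinite :=
    𝒰.le_cofinite_or_eq_pure.resolve_right fun ⟨a, ha⟩ => hnp a ha
  exact Filter.inter_mem hU (hle hs.compl_mem_cofinite)

/-- Members of a nonprincipal ultrafilter are infinite. -/
lemma Ultrafilter.infinite_of_mem {α : Type*} {𝒰 : Ultrafilter α} (hnp : ∀ a, 𝒰 ≠ pure a)
    {U : Set α} (hU : U ∈ 𝒰) : U.Infinite := fun hfin =>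
  𝒰.empty_notMem (by simpa using Ultrafilter.sdiff_finite_mem hnp hU hfin)

lemma FiniteToOne.tendsto_atTop {f : ℕ → ℕ} (hf : FiniteToOne f) :
    Filter.Tendsto f Filter.atTop Filter.atTop := by
  rw [← Nat.cofinite_eq_atTop]
  exact Filter.Tendsto.cofinite_of_finite_preimage_singleton hf

lemma IsRapid.exists_summable_image {𝒰 : Ultrafilter ℕ} (hr : IsRapid 𝒰) {g : ℕ → ℝ}
    (hpos : ∀ n, 0 < g n) (hg : Filter.Tendsto g Filter.atTop (nhds 0)) {f : ℕ → ℕ}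
    (hf : FiniteToOne f) : ∃ U ∈ 𝒰, Summable ((f '' U).indicator g) := by
  have hgf : Filter.Tendsto (g ∘ f) Filter.atTop (nhds 0) := hg.comp hf.tendsto_atTop
  have hex : ∀ n : ℕ, ∃ N, ∀ m ≥ N, g (f m) ≤ (1 / 2 : ℝ) ^ n := fun n =>
    Filter.eventually_atTop.mp (hgf.eventually_le_const (by positivity))
  choose h hh using hex
  obtain ⟨B, hB, hinf, hev⟩ := hr h
  refine ⟨B, hB, ?_⟩
  have hsum : Summable (g ∘ f ∘ Nat.nth (· ∈ B)) := by
    refine summable_geometric_two.of_norm_bounded_eventually_nat ?_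
    filter_upwards [hev] with n hn
    simpa [abs_of_pos (hpos _)] using hh n _ hn
  have hrange : Set.range (f ∘ Nat.nth (· ∈ B)) = f '' B := by
    rw [Set.range_comp]
    exact congrArg (f '' ·) (Nat.range_nth_of_infinite hinf)
  exact hrange ▸ hsum.indicator_range

/-- The largest `n ≤ m` such that `h` is bounded by `m` on the first `n` arguments. -/
noncomputable def boundedInitialLength (h : ℕ → ℕ) (m : ℕ) : ℕ :=
  open Classical in Nat.findGreatest (fun n => ∀ i < n, h i ≤ m) m

lemma boundedInitialLength_le (h : ℕ → ℕ) (m : ℕ) : boundedInitialLength h m ≤ m :=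
  Nat.findGreatest_le m

lemma le_of_lt_boundedInitialLength {h : ℕ → ℕ} {m n : ℕ} (hn : n < boundedInitialLength h m) :
    h n ≤ m := by
  classical
  exact Nat.findGreatest_spec (P := fun n => ∀ i < n, h i ≤ m) (Nat.zero_le m) (by simp) n
    (by unfold boundedInitialLength at hn; convert hn)

lemma monotone_boundedInitialLength (h : ℕ → ℕ) : Monotone (boundedInitialLength h) :=
  fun _ _ hab => Nat.findGreatest_mono (fun _ hn i hi => (hn i hi).trans hab) hab

lemma tendsto_boundedInitialLength (h : ℕ → ℕ) :
    Filter.Tendsto (boundedInitialLength h) Filter.atTop Filter.atTop := by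
  refine Filter.tendsto_atTop_atTop.mpr fun N => ⟨N + ∑ i ∈ Finset.range N, h i, fun m hm => ?_⟩
  refine Nat.le_findGreatest (by lia) fun i hi => ?_
  have := Finset.single_le_sum (f := h) (fun _ _ => Nat.zero_le _) (Finset.mem_range.mpr hi)
  lia

/-- A nonprincipal ultrafilter meeting every tall summable ideal is rapid. -/
lemma isRapid_of_exists_summable {𝒰 : Ultrafilter ℕ} (hnp : ∀ a : ℕ, 𝒰 ≠ pure a)
    (H : ∀ g : ℕ → ℝ, (∀ n, 0 < g n) → ¬ Summable g →
      Filter.Tendsto g Filter.atTop (nhds 0) → ∃ U ∈ 𝒰, Summable (U.indicator g)) :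
    IsRapid 𝒰 := by
  intro h
  set g : ℕ → ℝ := fun m => 1 / ((boundedInitialLength h m : ℝ) + 1) with hg
  have hpos : ∀ m, 0 < g m := fun m => by positivity
  have hanti : Antitone g := fun a b hab => by
    have := monotone_boundedInitialLength h hab
    simp only [hg]
    gcongr
  have hns : ¬ Summable g := fun hs => by
    have hharm : Summable fun m : ℕ => 1 / ((m : ℝ) + 1) := by
      refine hs.of_nonneg_of_le (fun m => by positivity) fun m => ?_
      have := boundedInitialLength_le h m
      simp only [hg]
      gcongr
    refine Real.not_summable_one_div_natCast ((summable_nat_add_iff 1).mp ?_)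
    simpa using hharm
  have hlim : Filter.Tendsto g Filter.atTop (nhds 0) :=
    tendsto_one_div_add_atTop_nhds_zero_nat.comp (tendsto_boundedInitialLength h)
  obtain ⟨U, hU, hsum⟩ := H g hpos hns hlim
  obtain ⟨s, hs⟩ := summable_iff_vanishing_norm.mp hsum 1 one_pos
  have hB : U \ ↑s ∈ 𝒰 := Ultrafilter.sdiff_finite_mem hnp hU s.finite_toSet
  have hinf : (U \ (s : Set ℕ)).Infinite := Ultrafilter.infinite_of_mem hnp hB
  refine ⟨U \ ↑s, hB, hinf, Filter.Eventually.of_forall fun n => ?_⟩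
  set e := Nat.nth (· ∈ U \ (s : Set ℕ)) with he
  have hmem : ∀ i, e i ∈ U \ (s : Set ℕ) := Nat.nth_mem_of_infinite hinf
  have hmono : StrictMono e := Nat.nth_strictMono hinf
  have hlt := hs ((Finset.range (n + 1)).image e) <| by
    rw [Finset.disjoint_left]
    intro x hx
    obtain ⟨i, -, rfl⟩ := Finset.mem_image.mp hx
    exact (hmem i).2
  rw [Finset.sum_image hmono.injective.injOn,
    Finset.sum_congr rfl fun i _ => Set.indicator_of_mem (hmem i).1 g] at hlt
  have hcard : (n + 1 : ℝ) * g (e n) ≤ ∑ i ∈ Finset.range (n + 1), g (e i) := by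
    have := Finset.card_nsmul_le_sum (Finset.range (n + 1)) (fun i => g (e i)) (g (e n))
      fun i hi => hanti (hmono.monotone (Nat.lt_succ_iff.mp (Finset.mem_range.mp hi)))
    simpa using this
  have hone : (n + 1 : ℝ) * g (e n) < 1 := hcard.trans_lt ((le_abs_self _).trans_lt hlt)
  rw [hg, mul_one_div, div_lt_one (by positivity)] at hone
  exact le_of_lt_boundedInitialLength (by exact_mod_cast lt_of_add_lt_add_right hone)

/-- An ultrafilter is rapid iff it is a weak `I_g`-ultrafilter for every tall
summable ideal `I_g`. -/
theorem rapid_iff_weak_Ig_ultrafilter (𝒰 : Ultrafilter ℕ) (hnp : ∀ a : ℕ, 𝒰 ≠ pure a) :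
    IsRapid 𝒰 ↔
      ∀ g : ℕ → ℝ, (∀ n, 0 < g n) → ¬ Summable g →
        Filter.Tendsto g Filter.atTop (nhds 0) →
        ∀ f : ℕ → ℕ, FiniteToOne f →
          ∃ U ∈ 𝒰, Summable ((f '' U).indicator g) := by
  exact ⟨fun hr g hpos _ hg f hf => hr.exists_summable_image hpos hg hf,
    fun H => isRapid_of_exists_summable hnp fun g hpos hns hg => by
      simpa using H g hpos hns hg id fun m => Set.finite_singleton m⟩
end

section
/- A nonprincipal ultrafilter 𝒰 on ℕ is hereditarily rapid if and only if 𝒰 is an I_g-ultrafilter for every tall summable ideal I_g; explicitly, 𝒰 is hereditarily rapid if and only if for every g : ℕ → (0, ∞) with Σₙ g(n) = ∞ and limₙ g(n) = 0 and every function f : ℕ → ℕ there exists U ∈ 𝒰 with Σ_{a ∈ f[U]} g(a) < ∞. -/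
open Set Filter Cardinal

/-- A nonnegative function is summable on an infinite set of naturals iff it is summable along
the increasing enumeration of that set. -/
lemma summable_indicator_iff_summable_nth (g : ℕ → ℝ) {B : Set ℕ} (hB : B.Infinite) :
    Summable (B.indicator g) ↔ Summable fun n => g (Nat.nth (· ∈ B) n) := by
  have hinj : Function.Injective (Nat.nth (· ∈ B)) := Nat.nth_injective hB
  rw [← hinj.summable_iff (f := B.indicator g)]
  · refine summable_congr fun n => ?_
    exact indicator_of_mem (Nat.nth_mem_of_infinite hB n) g
  · intro x hx
    refine indicator_of_notMem (fun hxB => hx ?_) g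
    exact (Nat.range_nth_of_infinite hB).symm ▸ hxB

/-- A null sequence is summable on some member of any rapid ultrafilter. -/
lemma IsRapid.exists_summable_indicator {𝒱 : Ultrafilter ℕ} (h𝒱 : IsRapid 𝒱) {g : ℕ → ℝ}
    (hpos : ∀ n, 0 < g n) (hg : Tendsto g atTop (nhds 0)) :
    ∃ B ∈ 𝒱, Summable (B.indicator g) := by
  have hsmall : ∀ n : ℕ, ∃ N, ∀ m ≥ N, g m < (1 / 2 : ℝ) ^ n := fun n =>
    eventually_atTop.1 (hg.eventually_lt_const (by positivity))
  choose h hh using hsmall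
  obtain ⟨B, hB𝒱, hB, hdom⟩ := h𝒱 h
  refine ⟨B, hB𝒱, (summable_indicator_iff_summable_nth g hB).2 ?_⟩
  refine summable_geometric_two.of_norm_bounded_eventually_nat ?_
  filter_upwards [hdom] with n hn
  rw [Real.norm_of_nonneg (hpos _).le]
  exact (hh n _ hn).le

/-- A null sequence is summable on some infinite set. -/
lemma exists_infinite_summable_indicator {g : ℕ → ℝ} (hpos : ∀ n, 0 < g n)
    (hg : Tendsto g atTop (nhds 0)) : ∃ S : Set ℕ, S.Infinite ∧ Summable (S.indicator g) := by
  obtain ⟨φ, hφ, hφg⟩ := extraction_forall_of_eventually (P := fun n m => g m < (1 / 2 : ℝ) ^ n)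
    fun n => hg.eventually_lt_const (by positivity)
  refine ⟨range φ, infinite_range_of_injective hφ.injective, ?_⟩
  rw [← hφ.injective.summable_iff fun x hx => indicator_of_notMem hx g]
  refine summable_geometric_two.of_nonneg_of_le (fun n => ?_) fun n => ?_
  · simp [(hpos _).le]
  · simpa using (hφg n).le

/-- The number of indices at which a function takes a value at most `m`,
counting only indices up to `m` (all of them, if the function dominates the identity). -/
def countValuesLE (h : ℕ → ℕ) (m : ℕ) : ℕ := ((Finset.range (m + 1)).filter (h · ≤ m)).card

lemma countValuesLE_le_succ (h : ℕ → ℕ) (m : ℕ) : countValuesLE h m ≤ m + 1 :=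
  (Finset.card_filter_le _ _).trans (Finset.card_range _).le

lemma countValuesLE_le_of_lt {h : ℕ → ℕ} (hh : Monotone h) {m n : ℕ} (hmn : m < h n) :
    countValuesLE h m ≤ n := by
  have hsub : (Finset.range (m + 1)).filter (h · ≤ m) ⊆ Finset.range n := by
    intro j hj
    rw [Finset.mem_filter] at hj
    rw [Finset.mem_range]
    by_contra hnj
    exact absurd (hh (not_lt.1 hnj)) (by omega)
  simpa [countValuesLE] using Finset.card_le_card hsub

lemma tendsto_countValuesLE {h : ℕ → ℕ} (hh : StrictMono h) :
    Tendsto (countValuesLE h) atTop atTop := by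
  refine tendsto_atTop.2 fun n => ?_
  filter_upwards [eventually_ge_atTop (h n)] with m hm
  have hsub : Finset.range n ⊆ (Finset.range (m + 1)).filter (h · ≤ m) := by
    intro j hj
    rw [Finset.mem_range] at hj
    have h₁ := hh hj
    have h₂ := hh.le_apply (x := j)
    simp only [Finset.mem_filter, Finset.mem_range]
    omega
  simpa [countValuesLE] using Finset.card_le_card hsub

/-- If the reciprocals of `countValuesLE h` are summable along the increasing enumeration of `B`,
then this enumeration eventually dominates `h`. -/
lemma eventually_le_nth_of_summable {h : ℕ → ℕ} (hh : Monotone h) {B : Set ℕ} (hB : B.Infinite)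
    (hs : Summable fun n => 1 / ((countValuesLE h (Nat.nth (· ∈ B) n) : ℝ) + 1)) :
    ∀ᶠ n in atTop, h n ≤ Nat.nth (· ∈ B) n := by
  set a : ℕ → ℝ := fun n => 1 / ((countValuesLE h (Nat.nth (· ∈ B) n) : ℝ) + 1) with ha
  have hlim := hs.hasSum.tendsto_sum_nat
  have h₁ := hlim.comp (tendsto_add_atTop_nat 1)
  have h₂ := hlim.comp (Nat.tendsto_div_const_atTop (n := 2) (by norm_num))
  have h₃ := h₁.sub h₂
  rw [sub_self] at h₃
  filter_upwards [h₃.eventually_lt_const (show (0 : ℝ) < 1 / 2 by norm_num)] with n hn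
  by_contra! hlt
  simp only [Function.comp_apply] at hn
  rw [← Finset.sum_Ico_eq_sub _ (by omega : n / 2 ≤ n + 1)] at hn
  have hterm : ∀ i ∈ Finset.Ico (n / 2) (n + 1), 1 / ((n : ℝ) + 1) ≤ a i := by
    intro i hi
    have hin : i ≤ n := by have := (Finset.mem_Ico.1 hi).2; omega
    have hle : Nat.nth (· ∈ B) i ≤ Nat.nth (· ∈ B) n := Nat.nth_monotone hB hin
    have hc : (countValuesLE h (Nat.nth (· ∈ B) i) : ℝ) ≤ n := by
      exact_mod_cast countValuesLE_le_of_lt hh (hle.trans_lt hlt)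
    simp only [ha]
    gcongr
  have hsum := Finset.card_nsmul_le_sum _ _ _ hterm
  rw [Nat.card_Ico, nsmul_eq_mul] at hsum
  have hcard : ((n : ℝ) + 1) / 2 ≤ ((n + 1 - n / 2 : ℕ) : ℝ) := by
    rw [div_le_iff₀ (by norm_num)]
    exact_mod_cast (by omega : n + 1 ≤ (n + 1 - n / 2) * 2)
  have hhalf : ((n : ℝ) + 1) / 2 * (1 / ((n : ℝ) + 1)) = 1 / 2 := by
    field_simp
  have hmul := mul_le_mul_of_nonneg_right hcard (show 0 ≤ 1 / ((n : ℝ) + 1) by positivity)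
  linarith

/-- An ultrafilter meeting every tall summable ideal is rapid. -/
lemma isRapid_of_forall_exists_summable_indicator {𝒱 : Ultrafilter ℕ}
    (h𝒱 : ∀ g : ℕ → ℝ, (∀ n, 0 < g n) → ¬ Summable g → Tendsto g atTop (nhds 0) →
      ∃ A ∈ 𝒱, Summable (A.indicator g)) : IsRapid 𝒱 := by
  intro h₀
  set h : ℕ → ℕ := fun n => n + ∑ i ∈ Finset.range (n + 1), h₀ i with hdef
  have hh : StrictMono h := strictMono_nat_of_lt_succ fun n => by
    simp only [hdef, Finset.sum_range_succ _ (n + 1)]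
    omega
  have hle : ∀ n, h₀ n ≤ h n := fun n => by
    simp only [hdef, Finset.sum_range_succ]
    omega
  set g : ℕ → ℝ := fun m => 1 / ((countValuesLE h m : ℝ) + 1) with gdef
  have hpos : ∀ m, 0 < g m := fun m => by positivity
  have hlim : Tendsto g atTop (nhds 0) :=
    tendsto_one_div_add_atTop_nhds_zero_nat.comp (tendsto_countValuesLE hh)
  have hdiv : ¬ Summable g := by
    intro hs
    refine Real.not_summable_one_div_natCast ((summable_nat_add_iff 2).1 ?_)
    refine hs.of_nonneg_of_le (fun m => by positivity) fun m => ?_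
    have hm : (countValuesLE h m : ℝ) + 1 ≤ ((m + 2 : ℕ) : ℝ) := by
      exact_mod_cast Nat.succ_le_succ (countValuesLE_le_succ h m)
    exact one_div_le_one_div_of_le (by positivity) hm
  obtain ⟨A, hA𝒱, hA⟩ := h𝒱 g hpos hdiv hlim
  obtain ⟨S, hSinf, hS⟩ := exists_infinite_summable_indicator hpos hlim
  have hinf : (A ∪ S).Infinite := hSinf.mono subset_union_right
  have hsum : Summable ((A ∪ S).indicator g) := by
    refine (hA.add hS).of_nonneg_of_le (fun m => indicator_nonneg (fun m _ => (hpos m).le) m)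
      fun m => ?_
    have := hpos m
    by_cases hmA : m ∈ A <;> by_cases hmS : m ∈ S <;> simp [hmA, hmS, this.le]
  refine ⟨A ∪ S, mem_of_superset hA𝒱 subset_union_left, hinf, ?_⟩
  filter_upwards [eventually_le_nth_of_summable hh.monotone hinf
    ((summable_indicator_iff_summable_nth g hinf).1 hsum)] with n hn
  exact (hle n).trans hn

/-- An ultrafilter is hereditarily rapid iff it is an `I_g`-ultrafilter for
every tall summable ideal `I_g`. -/
theorem hereditarilyRapid_iff_Ig_ultrafilter (𝒰 : Ultrafilter ℕ)
    (hnp : ∀ a : ℕ, 𝒰 ≠ pure a) :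
    IsHereditarilyRapid 𝒰 ↔
      ∀ g : ℕ → ℝ, (∀ n, 0 < g n) → ¬ Summable g →
        Filter.Tendsto g Filter.atTop (nhds 0) →
        ∀ f : ℕ → ℕ, ∃ U ∈ 𝒰, Summable ((f '' U).indicator g) := by
  constructor
  · rintro ⟨-, hmap⟩ g hpos - hg f
    obtain ⟨B, hB, hs⟩ := (hmap f).exists_summable_indicator hpos hg
    refine ⟨f ⁻¹' B, Ultrafilter.mem_map.1 hB, ?_⟩
    refine hs.of_nonneg_of_le (fun m => indicator_nonneg (fun m _ => (hpos m).le) m) fun m => ?_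
    exact indicator_le_indicator_of_subset (image_preimage_subset f B) (fun m => (hpos m).le) m
  · intro H
    have hmap : ∀ f : ℕ → ℕ, IsRapid (Ultrafilter.map f 𝒰) := fun f =>
      isRapid_of_forall_exists_summable_indicator fun g hpos hdiv hg => by
        obtain ⟨U, hU, hs⟩ := H g hpos hdiv hg f
        exact ⟨f '' U, image_mem_map hU, hs⟩
    exact ⟨by simpa using hmap id, hmap⟩
end

section
/- Let g : ℕ → (0, ∞) satisfy limₙ g(n) = 0, let f : ℕ → ℕ, and let F ⊆ ℕ be such that F ∖ f⁻¹[K] is an AP-set for every finite K ⊆ ℕ. Then for every nonempty finite set L ⊆ ℕ with Σ_{a ∈ f[L]} g(a) ≤ (2 − 2^{−|L|}) · max_{a ∈ f[L]} g(a) and every k ≥ 1, there exists a finite set L' ⊆ F that is an arithmetic progression of length k (i.e. L' = {a, a+d, …, a+(k−1)d} for some a and d ≥ 1) with min L' > max L, such that the set K = L ∪ L' satisfies Σ_{a ∈ f[K]} g(a) ≤ (2 − 2^{−|K|}) · max_{a ∈ f[K]} g(a). (This is the density of the sets D_{F,k} in the forcing poset used to prove the existence, under MA_ctble, of a hereditarily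 rapid ultrafilter disjoint from the van der Waerden ideal.) -/
open Set Filter Cardinal

/-- An AP-set contains arithmetic progressions of every finite length above any bound. -/
theorem IsAPSet.exists_progression_gt {A : Set ℕ} (hA : IsAPSet A) (N k : ℕ) :
    ∃ a d : ℕ, 1 ≤ d ∧ N < a ∧ ∀ i < k, a + i * d ∈ A := by
  obtain ⟨a, d, hd, h⟩ := hA (N + 1 + k)
  refine ⟨a + (N + 1) * d, d, hd, by nlinarith, fun i hi => ?_⟩
  have := h (N + 1 + i) (by omega)
  rwa [add_mul, ← add_assoc] at this

/-- The sum of a nonnegative function over a union is at most the sum of the sums. -/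
theorem sum_union_le_add {ι : Type*} [DecidableEq ι] (s t : Finset ι) {g : ι → ℝ}
    (hg : ∀ i, 0 ≤ g i) : ∑ i ∈ s ∪ t, g i ≤ ∑ i ∈ s, g i + ∑ i ∈ t, g i := by
  rw [← Finset.sum_union_inter]
  exact le_add_of_nonneg_right (Finset.sum_nonneg fun i _ => hg i)

/-- Increasing the cardinality by at least one halves `2 ^ (-card)`. -/
theorem two_zpow_neg_le_half {m n : ℕ} (h : m < n) :
    (2 : ℝ) ^ (-(n : ℤ)) ≤ (2 : ℝ) ^ (-(m : ℤ)) / 2 := by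
  have : (2 : ℝ) ^ (-(m : ℤ)) / 2 = (2 : ℝ) ^ (-(m : ℤ) - 1) := by
    rw [zpow_sub_one₀ two_ne_zero, div_eq_mul_inv]
  rw [this]
  exact zpow_le_zpow_right₀ one_le_two (by omega)

/-- Density of the sets `D_{F,k}` in the poset of finite sets `K` satisfying
`Σ_{a ∈ f[K]} g(a) ≤ (2 - 2^{-|K|}) · max_{a ∈ f[K]} g(a)`. -/
theorem density_DFk_for_hereditarilyRapid (g : ℕ → ℝ) (hgpos : ∀ n, 0 < g n)
    (hg0 : Filter.Tendsto g Filter.atTop (nhds 0)) (f : ℕ → ℕ) (F : Set ℕ)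
    (hF : ∀ K : Finset ℕ, IsAPSet (F \ f ⁻¹' (↑K : Set ℕ)))
    (L : Finset ℕ) (hLne : L.Nonempty)
    (hL : ∑ a ∈ L.image f, g a ≤
      (2 - (2 : ℝ) ^ (-(L.card : ℤ))) * sSup (g '' (f '' (↑L : Set ℕ))))
    (k : ℕ) (hk : 1 ≤ k) :
    ∃ (L' : Finset ℕ) (a d : ℕ), 1 ≤ d ∧
      L' = (Finset.range k).image (fun i => a + i * d) ∧
      (↑L' : Set ℕ) ⊆ F ∧ (∀ x ∈ L, ∀ y ∈ L', x < y) ∧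
      ∑ b ∈ (L ∪ L').image f, g b ≤
        (2 - (2 : ℝ) ^ (-((L ∪ L').card : ℤ))) *
          sSup (g '' (f '' (↑(L ∪ L') : Set ℕ))) := by
  set M := sSup (g '' (f '' (↑L : Set ℕ)))
  set p := (2 : ℝ) ^ (-(L.card : ℤ))
  have hp : 0 < p := by positivity
  have hbdd (s : Finset ℕ) : BddAbove (g '' (f '' (↑s : Set ℕ))) :=
    ((s.finite_toSet.image f).image g).bddAbove
  have hMpos : 0 < M := by
    obtain ⟨x, hx⟩ := hLne
    exact (hgpos (f x)).trans_le
      (le_csSup (hbdd L) (mem_image_of_mem g (mem_image_of_mem f (Finset.mem_coe.2 hx))))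
  have hkpos : (0 : ℝ) < k := by exact_mod_cast hk
  set ε := p / 2 * M / k with hε
  have hεpos : 0 < ε := by positivity
  obtain ⟨N, hN⟩ := eventually_atTop.1 (hg0.eventually_lt_const hεpos)
  obtain ⟨a, d, hd, ha, hA⟩ :=
    (hF (Finset.range N)).exists_progression_gt (L.sup id) k
  set L' := (Finset.range k).image (fun i => a + i * d)
  have hlt : ∀ x ∈ L, ∀ y ∈ L', x < y := by
    intro x hx y hy
    obtain ⟨i, -, rfl⟩ := Finset.mem_image.1 hy
    have : x ≤ L.sup id := Finset.le_sup (f := id) hx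
    nlinarith [Nat.zero_le (i * d)]
  have hsmall : ∑ b ∈ L'.image f, g b ≤ p / 2 * M := by
    have hle : ∀ b ∈ L'.image f, g b ≤ ε := by
      intro b hb
      obtain ⟨y, hy, rfl⟩ := Finset.mem_image.1 hb
      obtain ⟨i, hi, rfl⟩ := Finset.mem_image.1 hy
      have hnot := (hA i (Finset.mem_range.1 hi)).2
      simp only [Finset.coe_range, mem_preimage, mem_Iio, not_lt] at hnot
      exact (hN _ hnot).le
    have hcard : (L'.image f).card ≤ k :=
      Finset.card_image_le.trans (Finset.card_image_le.trans (Finset.card_range k).le)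
    calc ∑ b ∈ L'.image f, g b ≤ (L'.image f).card • ε := Finset.sum_le_card_nsmul _ _ _ hle
      _ ≤ k * ε := by
        rw [nsmul_eq_mul]
        gcongr
      _ = p / 2 * M := by
        rw [hε]
        field_simp
  have hcard : L.card < (L ∪ L').card := by
    have haL' : a ∈ L' := Finset.mem_image.2 ⟨0, Finset.mem_range.2 hk, by simp⟩
    refine Finset.card_lt_card (Finset.ssubset_iff_subset_ne.2 ⟨Finset.subset_union_left, ?_⟩)
    intro h
    have haL : a ∈ L := h ▸ Finset.mem_union_right L haL'
    exact lt_irrefl a (hlt a haL a haL')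
  have hsup : M ≤ sSup (g '' (f '' (↑(L ∪ L') : Set ℕ))) :=
    csSup_le_csSup (hbdd _) (((Finset.coe_nonempty.2 hLne).image f).image g)
      (image_mono (image_mono (Finset.coe_subset.2 Finset.subset_union_left)))
  have hq := two_zpow_neg_le_half hcard
  have hp1 : p ≤ 1 := zpow_le_one_of_nonpos₀ one_le_two (by omega)
  refine ⟨L', a, d, hd, rfl, ?_, hlt, ?_⟩
  · intro y hy
    obtain ⟨i, hi, rfl⟩ := Finset.mem_image.1 (Finset.mem_coe.1 hy)
    exact (hA i (Finset.mem_range.1 hi)).1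
  · rw [Finset.image_union]
    calc ∑ b ∈ L.image f ∪ L'.image f, g b
        ≤ ∑ b ∈ L.image f, g b + ∑ b ∈ L'.image f, g b :=
          sum_union_le_add _ _ fun n => (hgpos n).le
      _ ≤ (2 - p) * M + p / 2 * M := add_le_add hL hsmall
      _ = (2 - p / 2) * M := by ring
      _ ≤ _ := mul_le_mul (by linarith) hsup hMpos.le (by linarith)
end

section
/- The sets that are not AP-sets form a proper ideal on ℕ: for all A, B ⊆ ℕ, if A ∪ B is an AP-set then at least one of A and B is an AP-set; moreover ℕ itself is an AP-set. (This is a consequence of van der Waerden's theorem.) -/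
open Set Filter Cardinal

/-- The finite form of **van der Waerden's theorem**: for every `k` there is `N` such that every
coloring of the naturals below `N` with finitely many colors `κ` has a monochromatic arithmetic
progression of length `k`. -/
theorem exists_mono_arithmetic_progression_lt (κ : Type*) [Finite κ] (k : ℕ) :
    ∃ N : ℕ, ∀ C : ℕ → κ, ∃ (a d : ℕ) (c : κ),
      1 ≤ d ∧ ∀ i < k, a + i * d < N ∧ C (a + i * d) = c := by
  obtain ⟨ι, _, hι⟩ := Combinatorics.Line.exists_mono_in_high_dimension (Fin k) κ
  refine ⟨Fintype.card ι * k + 1, fun C => ?_⟩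
  obtain ⟨l, c, hl⟩ := hι fun v => C (∑ j, (v j : ℕ))
  have hsum (x : Fin k) : ∑ j, (l x j : ℕ) =
      ∑ j, (l.idxFun j).elim 0 (fun y => (y : ℕ)) +
        x * (Finset.univ.filter fun j => l.idxFun j = none).card := by
    rw [Finset.card_filter, Finset.mul_sum, ← Finset.sum_add_distrib]
    refine Finset.sum_congr rfl fun j _ => ?_
    cases h : l.idxFun j <;> simp [h]
  refine ⟨∑ j, (l.idxFun j).elim 0 (fun y => (y : ℕ)),
    (Finset.univ.filter fun j => l.idxFun j = none).card, c, ?_, fun i hi => ?_⟩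
  · obtain ⟨j, hj⟩ := l.proper
    exact Finset.card_pos.mpr ⟨j, by simpa using hj⟩
  · rw [← hsum ⟨i, hi⟩]
    refine ⟨Nat.lt_succ_of_le ?_, hl ⟨i, hi⟩⟩
    calc ∑ j, (l ⟨i, hi⟩ j : ℕ) ≤ ∑ _j : ι, k := Finset.sum_le_sum fun j _ => (Fin.is_lt _).le
      _ = Fintype.card ι * k := by simp

/-- The non-AP-sets form a proper ideal (a consequence of van der Waerden's
theorem). -/
theorem vdW_ideal_is_proper_ideal :
    (∀ A B : Set ℕ, IsAPSet (A ∪ B) → IsAPSet A ∨ IsAPSet B) ∧ IsAPSet Set.univ := by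
  refine ⟨fun A B hAB => ?_, fun k => ⟨0, 1, le_rfl, fun _ _ => mem_univ _⟩⟩
  by_contra! h
  simp only [IsAPSet, not_forall] at h
  obtain ⟨⟨k, hk⟩, m, hm⟩ := h
  obtain ⟨N, hN⟩ := exists_mono_arithmetic_progression_lt Prop (max k m)
  obtain ⟨a, d, hd, had⟩ := hAB N
  obtain ⟨b, e, c, he, hbe⟩ := hN fun n => a + n * d ∈ A
  have hde : 1 ≤ e * d := Nat.mul_pos he hd
  have hrw (i : ℕ) : a + b * d + i * (e * d) = a + (b + i * e) * d := by ring
  by_cases hc : c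
  · refine hk ⟨a + b * d, e * d, hde, fun i hi => ?_⟩
    rw [hrw]
    exact (hbe i (lt_max_of_lt_left hi)).2.mpr hc
  · refine hm ⟨a + b * d, e * d, hde, fun i hi => ?_⟩
    obtain ⟨hlt, hmono⟩ := hbe i (lt_max_of_lt_right hi)
    rw [hrw]
    exact (had _ hlt).resolve_left fun hA => hc (hmono.mp hA)
end
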